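/- Let ℱ be a construction scheme. Then ℱ is 2-Δ-capturing if and only if for every uncountable family 𝒮 of pairwise disjoint 2-element subsets of ω₁ there are infinitely many l ∈ ω for which some two distinct members of 𝒮 are Δ-captured at level l. -/

import Mathlib

noncomputable section

open scoped Classical

/-- The first uncountable ordinal. -/
def omegaOne : Ordinal := (Cardinal.aleph 1).ord

/-- A scheme type. -/
structure SchemeType where
  m : ℕ → ℕ
  n : ℕ → ℕ
  r : ℕ → ℕ
  m_zero : m 0 = 1
  n_ge : ∀ k, 2 ≤ n (k + 1)
  r_lt : ∀ k, r (k + 1) < m k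
  m_succ : ∀ k, m (k + 1) = r (k + 1) + (m k - r (k + 1)) * n (k + 1)

/-- `A` is an initial segment of `B`. -/
def InitSeg (A B : Finset Ordinal) : Prop := ∀ a ∈ A, ∀ b ∈ B, b < a → b ∈ A

/-- `D`, `R` form the canonical decomposition of `F ∈ ℱ_{k+1}`. -/
def IsDecomposition (T : SchemeType) (ℱ : Set (Finset Ordinal)) (k : ℕ)
    (F : Finset Ordinal) (D : ℕ → Finset Ordinal) (R : Finset Ordinal) : Prop :=
  (∀ i < T.n (k + 1), D i ∈ ℱ ∧ (D i).card = T.m k) ∧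
  F = (Finset.range (T.n (k + 1))).biUnion D ∧
  R.card = T.r (k + 1) ∧
  (∀ i < T.n (k + 1), ∀ j < T.n (k + 1), i ≠ j → D i ∩ D j = R) ∧
  (∀ i < T.n (k + 1), ∀ x ∈ R, ∀ y ∈ D i \ R, x < y) ∧
  (∀ i j, i < j → j < T.n (k + 1) → ∀ x ∈ D i \ R, ∀ y ∈ D j \ R, x < y)

/-- `ℱ` is a construction scheme of type `T` on `ω₁`. -/
structure IsConstructionScheme (T : SchemeType) (ℱ : Set (Finset Ordinal)) : Prop where
  nonempty_mem : ∀ F ∈ ℱ, F.Nonempty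
  mem_subset : ∀ F ∈ ℱ, ↑F ⊆ Set.Iio omegaOne
  cofinal : ∀ A : Finset Ordinal, ↑A ⊆ Set.Iio omegaOne → ∃ F ∈ ℱ, A ⊆ F
  card_eq : ∀ F ∈ ℱ, ∃ k, F.card = T.m k
  inter_initSeg : ∀ k : ℕ, ∀ E ∈ ℱ, ∀ F ∈ ℱ, E.card = T.m k → F.card = T.m k →
    InitSeg (E ∩ F) E ∧ InitSeg (E ∩ F) F
  decomp : ∀ k : ℕ, ∀ F ∈ ℱ, F.card = T.m (k + 1) → ∃ D R, IsDecomposition T ℱ k F D R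

/-- `ρ(α,β)`: least `k` such that `{α,β}` is included in a member of `ℱ_k`. -/
def rho (T : SchemeType) (ℱ : Set (Finset Ordinal)) (α β : Ordinal) : ℕ :=
  sInf {k | ∃ F ∈ ℱ, F.card = T.m k ∧ α ∈ F ∧ β ∈ F}

/-- `‖α‖_k`, the cardinality of `(α)_k \ {α}`. -/
def nrm (T : SchemeType) (ℱ : Set (Finset Ordinal)) (α : Ordinal) (k : ℕ) : ℕ :=
  Set.ncard {ξ : Ordinal | ξ < α ∧ rho T ℱ α ξ ≤ k}

/-- `Δ(α,β)`: least `k` with `‖α‖_k ≠ ‖β‖_k`. -/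
def deltaOrd (T : SchemeType) (ℱ : Set (Finset Ordinal)) (α β : Ordinal) : ℕ :=
  sInf {k | nrm T ℱ α k ≠ nrm T ℱ β k}

/-- `Ξ_α(k)`. -/
def Xi (T : SchemeType) (ℱ : Set (Finset Ordinal)) (α : Ordinal) (k : ℕ) : ℤ :=
  if k = 0 then 0
  else if h : ∃ i : ℕ, ∃ F ∈ ℱ, ∃ D R, F.card = T.m k ∧ α ∈ F ∧
      IsDecomposition T ℱ (k - 1) F D R ∧ i < T.n k ∧ α ∈ D i ∧ α ∉ R
  then (h.choose : ℤ) else -1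

/-- The `a`-th element of a finite set of ordinals, in increasing order. -/
def elt (A : Finset Ordinal) (a : ℕ) : Ordinal := (A.sort (· ≤ ·)).getD a 0

/-- The family `⟨D_0, …, D_{j-1}⟩` is Δ-captured at level `l`. -/
def DeltaCapturedFam (T : SchemeType) (ℱ : Set (Finset Ordinal)) (j : ℕ)
    (D : ℕ → Finset Ordinal) (l : ℕ) : Prop :=
  ∃ R : Finset Ordinal,
    (∀ i < j, ∀ i' < j, (D i).card = (D i').card) ∧
    (∀ i < j, ∀ i' < j, i ≠ i' → D i ∩ D i' = R) ∧
    (∀ i < j, ∀ x ∈ R, ∀ y ∈ D i \ R, x < y) ∧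
    (∀ i i', i < i' → i' < j → ∀ x ∈ D i \ R, ∀ y ∈ D i' \ R, x < y) ∧
    (∀ i < j, ∀ a < R.card, Xi T ℱ (elt (D i) a) l = -1) ∧
    (∀ i < j, ∀ a, R.card ≤ a → a < (D i).card → Xi T ℱ (elt (D i) a) l = (i : ℤ)) ∧
    (∀ i < j, ∀ i' < j, i ≠ i' → ∀ a, R.card ≤ a → a < (D i).card →
      deltaOrd T ℱ (elt (D i) a) (elt (D i') a) = l)

/-- The family `⟨D_0, …, D_{j-1}⟩` is captured at level `l`. -/
def CapturedFam (T : SchemeType) (ℱ : Set (Finset Ordinal)) (j : ℕ)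
    (D : ℕ → Finset Ordinal) (l : ℕ) : Prop :=
  DeltaCapturedFam T ℱ j D l ∧
  ∀ i < j, ∀ i' < j, i ≠ i' → ∀ a, (D i ∩ D i').card ≤ a → a < (D i).card →
    rho T ℱ (elt (D i) a) (elt (D i') a) = l

/-- The ordered pair `⟨A, B⟩`, as a family. -/
def pairFam (A B : Finset Ordinal) : ℕ → Finset Ordinal := fun i => if i = 0 then A else B

/-- A pair of ordinals `α < β` is captured at level `l`, i.e. `⟨{α},{β}⟩` is. -/
def CapturedPair (T : SchemeType) (ℱ : Set (Finset Ordinal)) (α β : Ordinal) (l : ℕ) : Prop :=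
  α < β ∧ Xi T ℱ α l = 0 ∧ Xi T ℱ β l = 1 ∧ deltaOrd T ℱ α β = l ∧ rho T ℱ α β = l

/-- `ℱ` is a 2-Δ-capturing scheme. -/
def TwoDeltaCapturing (T : SchemeType) (ℱ : Set (Finset Ordinal)) : Prop :=
  ∀ 𝒮 : Set (Finset Ordinal), (∀ A ∈ 𝒮, A.Nonempty ∧ ↑A ⊆ Set.Iio omegaOne) →
    ¬ 𝒮.Countable →
    {l : ℕ | ∃ A ∈ 𝒮, ∃ B ∈ 𝒮, A ≠ B ∧ DeltaCapturedFam T ℱ 2 (pairFam A B) l}.Infinite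

/-- `ℱ` is a 2-capturing scheme. -/
def TwoCapturing (T : SchemeType) (ℱ : Set (Finset Ordinal)) : Prop :=
  ∀ 𝒮 : Set (Finset Ordinal), (∀ A ∈ 𝒮, A.Nonempty ∧ ↑A ⊆ Set.Iio omegaOne) →
    ¬ 𝒮.Countable →
    {l : ℕ | ∃ A ∈ 𝒮, ∃ B ∈ 𝒮, A ≠ B ∧ CapturedFam T ℱ 2 (pairFam A B) l}.Infinite

/-- `ℱ` is a fully Δ-capturing scheme. -/
def FullyDeltaCapturing (T : SchemeType) (ℱ : Set (Finset Ordinal)) : Prop :=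
  ∀ 𝒮 : Set (Finset Ordinal), (∀ A ∈ 𝒮, A.Nonempty ∧ ↑A ⊆ Set.Iio omegaOne) →
    ¬ 𝒮.Countable →
    {l : ℕ | ∃ D : ℕ → Finset Ordinal, (∀ i < T.n l, D i ∈ 𝒮) ∧
      (∀ i < T.n l, ∀ i' < T.n l, i ≠ i' → D i ≠ D i') ∧
      DeltaCapturedFam T ℱ (T.n l) D l}.Infinite

/-- `E` is an `n`-entangled subset of the linear order `X`. -/
def IsNEntangled {X : Type*} [LinearOrder X] (E : Set X) (n : ℕ) : Prop :=
  ¬ E.Countable ∧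
  ∀ τ : Fin n → Fin 2, ∀ 𝒜 : Set (Fin n → X),
    (∀ a ∈ 𝒜, StrictMono a ∧ ∀ i, a i ∈ E) →
    (𝒜.Pairwise fun a b => ∀ i j, a i ≠ b j) →
    ¬ 𝒜.Countable →
    ∃ a ∈ 𝒜, ∃ b ∈ 𝒜, a ≠ b ∧ ∀ i, (a i < b i ↔ τ i = 0)
theorem exists_uncountable_fiber {ι κ : Type*} {X : Set ι} (hX : ¬ X.Countable) (f : ι → κ)
    (hf : (f '' X).Countable) : ∃ y, ¬ {x ∈ X | f x = y}.Countable := by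
  by_contra! h
  refine hX ((hf.biUnion fun y _ => h y).mono fun x hx => ?_)
  simp only [Set.mem_iUnion]
  exact ⟨f x, ⟨x, hx, rfl⟩, hx, rfl⟩

theorem exists_uncountable_pairwise_disjoint {ι κ : Type*} {X : Set ι} (hX : ¬ X.Countable)
    (p : ι → Finset κ) (hp : ∀ x ∈ X, (p x).Nonempty)
    (hc : ∀ a, {x ∈ X | a ∈ p x}.Countable) :
    ∃ Y ⊆ X, ¬ Y.Countable ∧ Y.Pairwise fun x y => Disjoint (p x) (p y) := by
  obtain ⟨Y, hY⟩ := zorn_subset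
    {Y : Set ι | Y ⊆ X ∧ Y.Pairwise fun x y => Disjoint (p x) (p y)} (by
      intro c hc hchain
      refine ⟨⋃₀ c, ⟨Set.sUnion_subset fun s hs => (hc hs).1, ?_⟩,
        fun s hs => Set.subset_sUnion_of_mem hs⟩
      exact (Set.pairwise_sUnion hchain.directedOn).2 fun s hs => (hc hs).2)
  refine ⟨Y, hY.prop.1, fun hcount => hX ?_, hY.prop.2⟩
  have hU : (⋃ y ∈ Y, (p y : Set κ)).Countable :=
    hcount.biUnion fun y _ => (p y).countable_toSet
  refine (hU.biUnion fun a _ => hc a).mono fun x hx => ?_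
  have key : ∃ a ∈ p x, ∃ y ∈ Y, a ∈ p y := by
    by_contra! h
    have hdisj : ∀ y ∈ Y, Disjoint (p x) (p y) := fun y hy =>
      Finset.disjoint_left.2 fun a ha => h a ha y hy
    have hxY : x ∈ Y := by
      refine hY.le_of_ge (y := insert x Y) ⟨Set.insert_subset hx hY.prop.1, ?_⟩
        (Set.subset_insert x Y) (Set.mem_insert x Y)
      exact hY.prop.2.insert fun y hy _ => ⟨hdisj y hy, (hdisj y hy).symm⟩
    obtain ⟨a, ha⟩ := hp x hx
    exact h a ha x hxY ha
  obtain ⟨a, ha, y, hy, hay⟩ := key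
  simp only [Set.mem_iUnion]
  exact ⟨a, ⟨y, hy, hay⟩, hx, ha⟩

/-- An uncountable family of finite sets has an uncountable subfamily with a common initial
segment `R` such that the least elements of the sets above `R` are pairwise distinct. The
subfamily is indexed by these least elements. -/
theorem exists_root {κ : Type*} [LinearOrder κ] {𝒮 : Set (Finset κ)} (h𝒮 : ¬ 𝒮.Countable) :
    ∃ (R : Finset κ) (X : Set κ) (G : κ → Finset κ), ¬ X.Countable ∧ ∀ α ∈ X,
      G α ∈ 𝒮 ∧ R ⊆ G α ∧ α ∈ G α \ R ∧
      (∀ x ∈ R, ∀ y ∈ G α \ R, x < y) ∧ ∀ y ∈ G α \ R, α ≤ y := by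
  obtain ⟨m, hm⟩ := exists_uncountable_fiber h𝒮 Finset.card (Set.to_countable _)
  let 𝒯 : Finset κ → Set (Finset κ) := fun R =>
    {A ∈ {A ∈ 𝒮 | A.card = m} | R ⊆ A ∧ ∀ x ∈ R, ∀ y ∈ A \ R, x < y}
  let P : ℕ → Prop := fun j => ∃ R : Finset κ, R.card = j ∧ ¬ (𝒯 R).Countable
  have hP0 : P 0 := ⟨∅, rfl, by simpa [𝒯] using hm⟩
  have hPle : ∀ j, P j → j ≤ m := by
    rintro j ⟨R, rfl, hR⟩
    obtain ⟨A, hA⟩ : (𝒯 R).Nonempty := by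
      by_contra h
      exact hR (by simp [Set.not_nonempty_iff_eq_empty.1 h])
    exact hA.1.2 ▸ Finset.card_le_card hA.2.1
  obtain ⟨R, hRcard, hR⟩ : P (Nat.findGreatest P m) := Nat.findGreatest_spec (Nat.zero_le m) hP0
  have hmax : ∀ α ∉ R, (𝒯 (insert α R)).Countable := by
    intro α hα
    by_contra h
    have hP : P (Nat.findGreatest P m + 1) :=
      ⟨insert α R, by rw [Finset.card_insert_of_notMem hα, hRcard], h⟩
    exact absurd (Nat.le_findGreatest (hPle _ hP) hP) (by omega)
  let X : Set κ := {α | ∃ A ∈ 𝒯 R, IsLeast (↑(A \ R) : Set κ) α}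
  have hX : ¬ X.Countable := by
    intro hX
    refine hR (((Set.countable_singleton R).union (hX.biUnion
      (t := fun α _ => {A ∈ 𝒯 R | IsLeast (↑(A \ R) : Set κ) α}) ?_)).mono ?_)
    · intro α ⟨_, _, hα⟩
      have hαR : α ∉ R := (Finset.mem_sdiff.1 hα.1).2
      refine (hmax α hαR).mono ?_
      rintro A ⟨⟨hA, hRA, hlt⟩, hleast⟩
      refine ⟨hA, Finset.insert_subset (Finset.mem_sdiff.1 hleast.1).1 hRA, ?_⟩
      intro x hx y hy
      simp only [Finset.mem_sdiff, Finset.mem_insert, not_or] at hx hy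
      have hyR : y ∈ A \ R := Finset.mem_sdiff.2 ⟨hy.1, hy.2.2⟩
      rcases hx with rfl | hx
      · exact lt_of_le_of_ne (hleast.2 hyR) (Ne.symm hy.2.1)
      · exact hlt x hx y hyR
    · intro A hA
      by_cases hAR : (A \ R).Nonempty
      · right
        simp only [Set.mem_iUnion]
        exact ⟨(A \ R).min' hAR, ⟨A, hA, Finset.isLeast_min' _ hAR⟩, hA,
          Finset.isLeast_min' _ hAR⟩
      · left
        rw [Finset.not_nonempty_iff_eq_empty, Finset.sdiff_eq_empty_iff_subset] at hAR
        exact Finset.Subset.antisymm hAR hA.2.1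
  have hG : ∀ α, ∃ A, α ∈ X → A ∈ 𝒯 R ∧ IsLeast (↑(A \ R) : Set κ) α := by
    intro α
    by_cases hα : α ∈ X
    · obtain ⟨A, hA⟩ := hα
      exact ⟨A, fun _ => hA⟩
    · exact ⟨∅, fun h => absurd h hα⟩
  choose G hG using hG
  refine ⟨R, X, G, hX, fun α hα => ?_⟩
  obtain ⟨hA, hleast⟩ := hG α hα
  exact ⟨hA.1.1, hA.2.1, hleast.1, hA.2.2, fun y hy => hleast.2 hy⟩

theorem elt_eq_orderEmbOfFin {A : Finset Ordinal} {a : ℕ} (ha : a < A.card) :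
    elt A a = A.orderEmbOfFin rfl ⟨a, ha⟩ := by
  simp [elt, Finset.orderEmbOfFin_apply, ha]

theorem elt_mem {A : Finset Ordinal} {a : ℕ} (ha : a < A.card) : elt A a ∈ A := by
  rw [elt_eq_orderEmbOfFin ha]
  exact A.orderEmbOfFin_mem rfl _

theorem card_filter_lt_elt {A : Finset Ordinal} {a : ℕ} (ha : a < A.card) :
    (A.filter (· < elt A a)).card = a := by
  have h : A.filter (· < elt A a) =
      (Finset.Iio (⟨a, ha⟩ : Fin A.card)).map (A.orderEmbOfFin rfl).toEmbedding := by
    ext y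
    simp only [Finset.mem_filter, Finset.mem_map, Finset.mem_Iio, elt_eq_orderEmbOfFin ha]
    constructor
    · rintro ⟨hy, hlt⟩
      obtain ⟨b, rfl⟩ : y ∈ Set.range (A.orderEmbOfFin rfl) := by
        rw [Finset.range_orderEmbOfFin]; exact hy
      exact ⟨b, (A.orderEmbOfFin rfl).lt_iff_lt.1 hlt, rfl⟩
    · rintro ⟨b, hb, rfl⟩
      exact ⟨A.orderEmbOfFin_mem rfl b, (A.orderEmbOfFin rfl).lt_iff_lt.2 hb⟩
  rw [h]
  simp

theorem elt_mem_iff {A R : Finset Ordinal} (hRA : R ⊆ A) (hR : ∀ x ∈ R, ∀ y ∈ A \ R, x < y)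
    {a : ℕ} (ha : a < A.card) : elt A a ∈ R ↔ a < R.card := by
  constructor
  · intro h
    refine (card_filter_lt_elt ha).symm.trans_lt (Finset.card_lt_card ?_)
    refine (Finset.ssubset_iff_of_subset fun y hy => ?_).2 ⟨elt A a, h, by simp⟩
    rw [Finset.mem_filter] at hy
    by_contra hyR
    exact lt_asymm hy.2 (hR _ h y (Finset.mem_sdiff.2 ⟨hy.1, hyR⟩))
  · intro h
    by_contra hn
    refine h.not_ge (le_of_le_of_eq (Finset.card_le_card fun y hy => ?_) (card_filter_lt_elt ha))
    exact Finset.mem_filter.2 ⟨hRA hy, hR y hy _ (Finset.mem_sdiff.2 ⟨elt_mem ha, hn⟩)⟩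

theorem elt_pair_zero {α β : Ordinal} (h : α < β) : elt {α, β} 0 = α := by
  rw [elt, Finset.sort_insert _ (by simpa using h.le) (by simpa using h.ne)]
  simp

theorem elt_pair_one {α β : Ordinal} (h : α < β) : elt {α, β} 1 = β := by
  rw [elt, Finset.sort_insert _ (by simpa using h.le) (by simpa using h.ne)]
  simp

theorem countable_Iic_of_lt_omegaOne {α : Ordinal} (h : α < omegaOne) :
    (Set.Iic α).Countable := by
  have h1 : Order.succ α < omegaOne :=
    (Cardinal.isSuccLimit_ord (Cardinal.aleph0_le_aleph 1)).succ_lt h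
  rw [← Order.Iio_succ, ← Cardinal.le_aleph0_iff_set_countable, Cardinal.mk_Iio_ordinal,
    Cardinal.lift_le_aleph0, ← Order.lt_succ_iff, Cardinal.succ_aleph0]
  exact Cardinal.lt_ord.1 h1

theorem SchemeType.m_strictMono (T : SchemeType) : StrictMono T.m := by
  refine strictMono_nat_of_lt_succ fun k => ?_
  rw [T.m_succ k]
  have h1 := T.r_lt k
  have h2 := Nat.mul_le_mul_left (T.m k - T.r (k + 1)) (T.n_ge k)
  omega

namespace IsDecomposition

variable {T : SchemeType} {ℱ : Set (Finset Ordinal)} {k : ℕ} {F : Finset Ordinal}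
  {D : ℕ → Finset Ordinal} {R : Finset Ordinal}

theorem root_subset (h : IsDecomposition T ℱ k F D R) {i : ℕ} (hi : i < T.n (k + 1)) :
    R ⊆ D i := by
  have hn := T.n_ge k
  obtain ⟨j, hj, hij⟩ : ∃ j < T.n (k + 1), i ≠ j := by
    rcases Nat.eq_zero_or_pos i with rfl | h0
    · exact ⟨1, by omega, by omega⟩
    · exact ⟨0, by omega, by omega⟩
  exact h.2.2.2.1 i hi j hj hij ▸ Finset.inter_subset_left

theorem subset (h : IsDecomposition T ℱ k F D R) {i : ℕ} (hi : i < T.n (k + 1)) : D i ⊆ F := by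
  rw [h.2.1]
  exact Finset.subset_biUnion_of_mem D (Finset.mem_range.2 hi)

theorem exists_mem (h : IsDecomposition T ℱ k F D R) {x : Ordinal} (hx : x ∈ F) :
    ∃ i < T.n (k + 1), x ∈ D i := by
  simpa [h.2.1] using hx

theorem filter_lt_of_mem (h : IsDecomposition T ℱ k F D R) {i : ℕ} (hi : i < T.n (k + 1))
    {α : Ordinal} (hα : α ∈ R) : F.filter (· < α) = (D i).filter (· < α) := by
  ext y
  simp only [Finset.mem_filter, and_congr_left_iff]
  refine fun hy => ⟨fun hyF => ?_, fun hyD => h.subset hi hyD⟩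
  obtain ⟨j, hj, hyj⟩ := h.exists_mem hyF
  refine h.root_subset hi ?_
  by_contra hyR
  exact lt_asymm hy (h.2.2.2.2.1 j hj α hα y (Finset.mem_sdiff.2 ⟨hyj, hyR⟩))

theorem card_filter_lt_of_mem (h : IsDecomposition T ℱ k F D R) {i : ℕ} (hi : i < T.n (k + 1))
    {α : Ordinal} (hα : α ∈ R) : ((D i).filter (· < α)).card < T.r (k + 1) := by
  rw [← h.2.2.1]
  refine Finset.card_lt_card ((Finset.ssubset_iff_of_subset fun y hy => ?_).2 ⟨α, hα, by simp⟩)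
  rw [Finset.mem_filter] at hy
  by_contra hyR
  exact lt_asymm hy.2 (h.2.2.2.2.1 i hi α hα y (Finset.mem_sdiff.2 ⟨hy.1, hyR⟩))

theorem le_card_filter_lt (h : IsDecomposition T ℱ k F D R) {i : ℕ} (hi : i < T.n (k + 1))
    {α : Ordinal} (hα : α ∈ D i \ R) : T.r (k + 1) ≤ ((D i).filter (· < α)).card := by
  rw [← h.2.2.1]
  exact Finset.card_le_card fun y hy =>
    Finset.mem_filter.2 ⟨h.root_subset hi hy, h.2.2.2.2.1 i hi y hy α hα⟩

theorem card_filter_lt (h : IsDecomposition T ℱ k F D R) {i : ℕ} (hi : i < T.n (k + 1))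
    {α : Ordinal} (hα : α ∈ D i \ R) :
    (F.filter (· < α)).card =
      ((D i).filter (· < α)).card + i * (T.m k - T.r (k + 1)) := by
  have hF : F.filter (· < α) =
      (D i).filter (· < α) ∪ (Finset.range i).biUnion fun j => D j \ R := by
    ext y
    simp only [Finset.mem_union, Finset.mem_filter, Finset.mem_biUnion, Finset.mem_range]
    constructor
    · rintro ⟨hyF, hy⟩
      obtain ⟨j, hj, hyj⟩ := h.exists_mem hyF
      by_cases hyR : y ∈ R
      · exact Or.inl ⟨h.root_subset hi hyR, hy⟩
      have hyj' : y ∈ D j \ R := Finset.mem_sdiff.2 ⟨hyj, hyR⟩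
      rcases lt_trichotomy j i with hji | rfl | hij
      · exact Or.inr ⟨j, hji, hyj'⟩
      · exact Or.inl ⟨hyj, hy⟩
      · exact absurd hy (lt_asymm (h.2.2.2.2.2 i j hij hj α hα y hyj'))
    · rintro (⟨hyD, hy⟩ | ⟨j, hji, hyj⟩)
      · exact ⟨h.subset hi hyD, hy⟩
      · exact ⟨h.subset (hji.trans hi) (Finset.mem_sdiff.1 hyj).1,
          h.2.2.2.2.2 j i hji hi y hyj α hα⟩
  have hdisj : Disjoint ((D i).filter (· < α)) ((Finset.range i).biUnion fun j => D j \ R) := by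
    refine Finset.disjoint_left.2 fun y hy hy' => ?_
    simp only [Finset.mem_biUnion, Finset.mem_range, Finset.mem_sdiff, Finset.mem_filter] at hy hy'
    obtain ⟨j, hji, hyj, hyR⟩ := hy'
    refine hyR (h.2.2.2.1 i hi j (hji.trans hi) hji.ne' ▸ Finset.mem_inter.2 ⟨hy.1, hyj⟩)
  rw [hF, Finset.card_union_of_disjoint hdisj, Finset.card_biUnion]
  · rw [Finset.sum_const_nat (m := T.m k - T.r (k + 1)), Finset.card_range]
    intro j hj
    have hj' : j < T.n (k + 1) := (Finset.mem_range.1 hj).trans hi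
    rw [Finset.card_sdiff_of_subset (h.root_subset hj'), (h.1 j hj').2, h.2.2.1]
  · intro j hj j' hj' hne
    refine Finset.disjoint_left.2 fun y hy hy' => ?_
    rw [Finset.mem_sdiff] at hy hy'
    refine hy.2 (h.2.2.2.1 j ((Finset.mem_range.1 hj).trans hi) j'
      ((Finset.mem_range.1 hj').trans hi) hne ▸ Finset.mem_inter.2 ⟨hy.1, hy'.1⟩)

end IsDecomposition

namespace IsConstructionScheme

variable {T : SchemeType} {ℱ : Set (Finset Ordinal)}

theorem exists_subset_level (hS : IsConstructionScheme T ℱ) {k l : ℕ} (hkl : k ≤ l)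
    {x : Ordinal} {F : Finset Ordinal} (hF : F ∈ ℱ) (hFl : F.card = T.m l) (hx : x ∈ F) :
    ∃ E ∈ ℱ, E.card = T.m k ∧ x ∈ E ∧ E ⊆ F := by
  induction l, hkl using Nat.le_induction generalizing F with
  | base => exact ⟨F, hF, hFl, hx, subset_rfl⟩
  | succ l hkl ih =>
    obtain ⟨D, R, hD⟩ := hS.decomp l F hF hFl
    obtain ⟨i, hi, hxi⟩ := hD.exists_mem hx
    obtain ⟨E, hE, hEk, hxE, hED⟩ := ih (hD.1 i hi).1 (hD.1 i hi).2 hxi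
    exact ⟨E, hE, hEk, hxE, hED.trans (hD.subset hi)⟩

theorem exists_level_superset (hS : IsConstructionScheme T ℱ) {A : Finset Ordinal}
    (hA : ↑A ⊆ Set.Iio omegaOne) : ∃ k, ∃ F ∈ ℱ, F.card = T.m k ∧ A ⊆ F := by
  obtain ⟨F, hF, hAF⟩ := hS.cofinal A hA
  obtain ⟨k, hk⟩ := hS.card_eq F hF
  exact ⟨k, F, hF, hk, hAF⟩

theorem exists_level_mem (hS : IsConstructionScheme T ℱ) {α : Ordinal} (hα : α < omegaOne)
    (k : ℕ) : ∃ F ∈ ℱ, F.card = T.m k ∧ α ∈ F := by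
  let N : Finset Ordinal := (Finset.range (T.m k)).image Nat.cast
  have hN : N.card = T.m k := by
    rw [Finset.card_image_of_injective _ Nat.cast_injective, Finset.card_range]
  have hω : Ordinal.omega0 ≤ omegaOne := by
    rw [← Cardinal.ord_aleph0]
    exact Cardinal.ord_mono (Cardinal.aleph0_le_aleph 1)
  obtain ⟨l, F, hF, hFl, hsub⟩ := hS.exists_level_superset (A := insert α N) (by
    intro x hx
    simp only [N, Finset.coe_insert, Finset.coe_image, Set.mem_insert_iff, Set.mem_image] at hx
    rcases hx with rfl | ⟨n, _, rfl⟩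
    · exact hα
    · exact (Ordinal.natCast_lt_omega0 n).trans_le hω)
  have hkl : k ≤ l := by
    rw [← T.m_strictMono.le_iff_le, ← hFl, ← hN]
    exact Finset.card_le_card ((Finset.subset_insert _ _).trans hsub)
  obtain ⟨E, hE, hEk, hαE, _⟩ :=
    hS.exists_subset_level hkl hF hFl (hsub (Finset.mem_insert_self _ _))
  exact ⟨E, hE, hEk, hαE⟩

theorem mem_of_lt (hS : IsConstructionScheme T ℱ) {k l : ℕ} (hkl : k ≤ l)
    {E G : Finset Ordinal} (hE : E ∈ ℱ) (hEk : E.card = T.m k) (hG : G ∈ ℱ)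
    (hGl : G.card = T.m l) {x y : Ordinal} (hxE : x ∈ E) (hxG : x ∈ G) (hyE : y ∈ E)
    (hyx : y < x) : y ∈ G := by
  obtain ⟨E', hE', hE'k, hxE', hsub⟩ := hS.exists_subset_level hkl hG hGl hxG
  exact hsub (Finset.mem_inter.1 ((hS.inter_initSeg k E hE E' hE' hEk hE'k).1 x
    (Finset.mem_inter.2 ⟨hxE, hxE'⟩) y hyE hyx)).2

theorem rho_le_iff (hS : IsConstructionScheme T ℱ) {k : ℕ} {F : Finset Ordinal} (hF : F ∈ ℱ)
    (hFk : F.card = T.m k) {α ξ : Ordinal} (hα : α ∈ F) (hξ : ξ < α) :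
    rho T ℱ α ξ ≤ k ↔ ξ ∈ F := by
  constructor
  · intro h
    have hα1 : α < omegaOne := hS.mem_subset F hF hα
    obtain ⟨j, E, hE, hEj, hsub⟩ := hS.exists_level_superset (A := {α, ξ}) (by
      intro x hx
      simp only [Finset.coe_insert, Finset.coe_singleton, Set.mem_insert_iff,
        Set.mem_singleton_iff] at hx
      rcases hx with rfl | rfl
      · exact hα1
      · exact hξ.trans hα1)
    obtain ⟨E, hE, hEj, hαE, hξE⟩ := Nat.sInf_mem
      (s := {k | ∃ F ∈ ℱ, F.card = T.m k ∧ α ∈ F ∧ ξ ∈ F})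
      ⟨j, E, hE, hEj, hsub (by simp), hsub (by simp)⟩
    exact hS.mem_of_lt h hE hEj hF hFk hαE hα hξE hξ
  · exact fun h => Nat.sInf_le ⟨F, hF, hFk, hα, h⟩

theorem nrm_eq_card (hS : IsConstructionScheme T ℱ) {k : ℕ} {F : Finset Ordinal} (hF : F ∈ ℱ)
    (hFk : F.card = T.m k) {α : Ordinal} (hα : α ∈ F) :
    nrm T ℱ α k = (F.filter (· < α)).card := by
  rw [nrm, ← Set.ncard_coe_finset]
  congr 1
  ext ξ
  simp only [Set.mem_ofPred_eq, Finset.coe_filter]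
  constructor
  · rintro ⟨h1, h2⟩
    exact ⟨(hS.rho_le_iff hF hFk hα h1).1 h2, h1⟩
  · rintro ⟨h1, h2⟩
    exact ⟨h2, (hS.rho_le_iff hF hFk hα h2).2 h1⟩

theorem nrm_lt (hS : IsConstructionScheme T ℱ) {α : Ordinal} (hα : α < omegaOne) (k : ℕ) :
    nrm T ℱ α k < T.m k := by
  obtain ⟨F, hF, hFk, hαF⟩ := hS.exists_level_mem hα k
  rw [hS.nrm_eq_card hF hFk hαF, ← hFk]
  exact Finset.card_lt_card
    ((Finset.ssubset_iff_of_subset (Finset.filter_subset _ _)).2 ⟨α, hαF, by simp⟩)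

theorem nrm_succ_of_mem_root (hS : IsConstructionScheme T ℱ) {k : ℕ} {F : Finset Ordinal}
    (hF : F ∈ ℱ) (hFk : F.card = T.m (k + 1)) {D : ℕ → Finset Ordinal} {R : Finset Ordinal}
    (hD : IsDecomposition T ℱ k F D R) {α : Ordinal} (hα : α ∈ R) :
    nrm T ℱ α k < T.r (k + 1) ∧ nrm T ℱ α (k + 1) = nrm T ℱ α k := by
  have h0 : 0 < T.n (k + 1) := by have := T.n_ge k; omega
  have hα0 := hD.root_subset h0 hα
  rw [hS.nrm_eq_card (hD.1 0 h0).1 (hD.1 0 h0).2 hα0,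
    hS.nrm_eq_card hF hFk (hD.subset h0 hα0)]
  exact ⟨hD.card_filter_lt_of_mem h0 hα, by rw [hD.filter_lt_of_mem h0 hα]⟩

theorem nrm_succ_of_notMem_root (hS : IsConstructionScheme T ℱ) {k : ℕ} {F : Finset Ordinal}
    (hF : F ∈ ℱ) (hFk : F.card = T.m (k + 1)) {D : ℕ → Finset Ordinal} {R : Finset Ordinal}
    (hD : IsDecomposition T ℱ k F D R) {i : ℕ} (hi : i < T.n (k + 1)) {α : Ordinal}
    (hα : α ∈ D i \ R) :
    T.r (k + 1) ≤ nrm T ℱ α k ∧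
      nrm T ℱ α (k + 1) = nrm T ℱ α k + i * (T.m k - T.r (k + 1)) := by
  have hαi := (Finset.mem_sdiff.1 hα).1
  rw [hS.nrm_eq_card (hD.1 i hi).1 (hD.1 i hi).2 hαi,
    hS.nrm_eq_card hF hFk (hD.subset hi hαi)]
  exact ⟨hD.le_card_filter_lt hi hα, hD.card_filter_lt hi hα⟩

theorem xi_succ (hS : IsConstructionScheme T ℱ) {α : Ordinal} (hα : α < omegaOne) (k : ℕ) :
    (nrm T ℱ α k < T.r (k + 1) ∧ Xi T ℱ α (k + 1) = -1 ∧
      nrm T ℱ α (k + 1) = nrm T ℱ α k) ∨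
    (T.r (k + 1) ≤ nrm T ℱ α k ∧ ∃ i : ℕ, Xi T ℱ α (k + 1) = i ∧
      nrm T ℱ α (k + 1) = nrm T ℱ α k + i * (T.m k - T.r (k + 1))) := by
  rw [Xi, if_neg k.succ_ne_zero]
  split_ifs with h
  · right
    obtain ⟨F, hF, D, R, hFk, hαF, hD, hi, hαi, hαR⟩ := h.choose_spec
    obtain ⟨h1, h2⟩ := hS.nrm_succ_of_notMem_root hF hFk hD hi (Finset.mem_sdiff.2 ⟨hαi, hαR⟩)
    exact ⟨h1, h.choose, rfl, h2⟩
  · left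
    obtain ⟨F, hF, hFk, hαF⟩ := hS.exists_level_mem hα (k + 1)
    obtain ⟨D, R, hD⟩ := hS.decomp k F hF hFk
    obtain ⟨i, hi, hαi⟩ := hD.exists_mem hαF
    have hαR : α ∈ R := by
      by_contra hαR
      exact h ⟨i, F, hF, D, R, hFk, hαF, hD, hi, hαi, hαR⟩
    obtain ⟨h1, h2⟩ := hS.nrm_succ_of_mem_root hF hFk hD hαR
    exact ⟨h1, rfl, h2⟩

theorem nrm_eq_and_xi_eq_of_nrm_succ_eq (hS : IsConstructionScheme T ℱ) {α β : Ordinal}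
    (hα : α < omegaOne) (hβ : β < omegaOne) {k : ℕ}
    (h : nrm T ℱ α (k + 1) = nrm T ℱ β (k + 1)) :
    nrm T ℱ α k = nrm T ℱ β k ∧ Xi T ℱ α (k + 1) = Xi T ℱ β (k + 1) := by
  have hαk := hS.nrm_lt hα k
  have hβk := hS.nrm_lt hβ k
  rcases hS.xi_succ hα k with ⟨a1, a2, a3⟩ | ⟨a1, i, a2, a3⟩ <;>
  rcases hS.xi_succ hβ k with ⟨b1, b2, b3⟩ | ⟨b1, j, b2, b3⟩
  · exact ⟨by omega, by rw [a2, b2]⟩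
  · omega
  · omega
  · have hij : i = j := by
      rcases lt_trichotomy i j with hlt | rfl | hlt
      · have := Nat.mul_le_mul_right (T.m k - T.r (k + 1)) (Nat.succ_le_of_lt hlt)
        rw [Nat.succ_mul] at this
        omega
      · rfl
      · have := Nat.mul_le_mul_right (T.m k - T.r (k + 1)) (Nat.succ_le_of_lt hlt)
        rw [Nat.succ_mul] at this
        omega
    subst hij
    exact ⟨by omega, by rw [a2, b2]⟩

theorem nrm_eq_of_le (hS : IsConstructionScheme T ℱ) {α β : Ordinal} (hα : α < omegaOne)
    (hβ : β < omegaOne) {j k : ℕ} (hjk : j ≤ k) (h : nrm T ℱ α k = nrm T ℱ β k) :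
    nrm T ℱ α j = nrm T ℱ β j := by
  induction k, hjk using Nat.le_induction with
  | base => exact h
  | succ k hjk ih => exact ih (hS.nrm_eq_and_xi_eq_of_nrm_succ_eq hα hβ h).1

theorem xi_eq_of_mem_sdiff (hS : IsConstructionScheme T ℱ) {k : ℕ} {F : Finset Ordinal}
    (hF : F ∈ ℱ) (hFk : F.card = T.m (k + 1)) {D : ℕ → Finset Ordinal} {R : Finset Ordinal}
    (hD : IsDecomposition T ℱ k F D R) {i : ℕ} (hi : i < T.n (k + 1)) {α : Ordinal}
    (hα : α ∈ D i \ R) : Xi T ℱ α (k + 1) = i := by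
  obtain ⟨h1, h2⟩ := hS.nrm_succ_of_notMem_root hF hFk hD hi hα
  have hα1 := hS.mem_subset _ (hD.1 i hi).1 (Finset.mem_sdiff.1 hα).1
  rcases hS.xi_succ hα1 k with ⟨a1, _⟩ | ⟨_, j, a2, a3⟩
  · omega
  · have hs : 0 < T.m k - T.r (k + 1) := Nat.sub_pos_of_lt (T.r_lt k)
    have : i * (T.m k - T.r (k + 1)) = j * (T.m k - T.r (k + 1)) := by omega
    rw [a2, Nat.eq_of_mul_eq_mul_right hs this]

theorem together_mono (hS : IsConstructionScheme T ℱ) {k l : ℕ} (hkl : k ≤ l)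
    {x α : Ordinal} (hxα : x < α) (h : ∃ E ∈ ℱ, E.card = T.m k ∧ x ∈ E ∧ α ∈ E) :
    ∃ E ∈ ℱ, E.card = T.m l ∧ x ∈ E ∧ α ∈ E := by
  obtain ⟨E, hE, hEk, hxE, hαE⟩ := h
  obtain ⟨F, hF, hFl, hαF⟩ := hS.exists_level_mem (hS.mem_subset E hE hαE) l
  exact ⟨F, hF, hFl, hS.mem_of_lt hkl hE hEk hF hFl hαE hαF hxE hxα, hαF⟩

theorem nrm_le_nrm (hS : IsConstructionScheme T ℱ) {k : ℕ} {x α : Ordinal} (hxα : x ≤ α)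
    (h : ∃ E ∈ ℱ, E.card = T.m k ∧ x ∈ E ∧ α ∈ E) : nrm T ℱ x k ≤ nrm T ℱ α k := by
  obtain ⟨E, hE, hEk, hxE, hαE⟩ := h
  rw [hS.nrm_eq_card hE hEk hxE, hS.nrm_eq_card hE hEk hαE]
  refine Finset.card_le_card fun y hy => ?_
  rw [Finset.mem_filter] at hy ⊢
  exact ⟨hy.1, hy.2.trans_le hxα⟩

/-- If `x < α` lie in a common member of `ℱ_k`, then `Ξ_x(k+1)` is `-1` or `Ξ_α(k+1)`. -/
theorem xi_succ_eq_or (hS : IsConstructionScheme T ℱ) {k : ℕ} {x α : Ordinal} (hxα : x < α)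
    (h : ∃ E ∈ ℱ, E.card = T.m k ∧ x ∈ E ∧ α ∈ E) :
    Xi T ℱ x (k + 1) = -1 ∨ Xi T ℱ x (k + 1) = Xi T ℱ α (k + 1) := by
  obtain ⟨E, hE, hEk, hxE, hαE⟩ := h
  have hα := hS.mem_subset E hE hαE
  obtain ⟨F, hF, hFk, hαF⟩ := hS.exists_level_mem hα (k + 1)
  obtain ⟨D, R, hD⟩ := hS.decomp k F hF hFk
  obtain ⟨i, hi, hαi⟩ := hD.exists_mem hαF
  have hxi : x ∈ D i := hS.mem_of_lt le_rfl hE hEk (hD.1 i hi).1 (hD.1 i hi).2 hαE hαi hxE hxα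
  by_cases hxR : x ∈ R
  · left
    rcases hS.xi_succ (hxα.trans hα) k with ⟨_, h, _⟩ | ⟨h, _⟩
    · exact h
    · exact absurd (hS.nrm_succ_of_mem_root hF hFk hD hxR).1 h.not_gt
  · right
    have hαR : α ∉ R := fun hαR =>
      lt_asymm hxα (hD.2.2.2.2.1 i hi α hαR x (Finset.mem_sdiff.2 ⟨hxi, hxR⟩))
    rw [hS.xi_eq_of_mem_sdiff hF hFk hD hi (Finset.mem_sdiff.2 ⟨hxi, hxR⟩),
      hS.xi_eq_of_mem_sdiff hF hFk hD hi (Finset.mem_sdiff.2 ⟨hαi, hαR⟩)]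

/-- Elements in the same position of the closures of `α` and `β` at level `k` keep having equal
norms as long as `α` and `β` do. -/
theorem nrm_eq_of_together (hS : IsConstructionScheme T ℱ) {k l : ℕ} (hkl : k ≤ l)
    {x y α β : Ordinal} (hxα : x < α) (hyβ : y < β)
    (hx : ∃ E ∈ ℱ, E.card = T.m k ∧ x ∈ E ∧ α ∈ E)
    (hy : ∃ E ∈ ℱ, E.card = T.m k ∧ y ∈ E ∧ β ∈ E)
    (hxy : nrm T ℱ x k = nrm T ℱ y k) (hαβ : nrm T ℱ α l = nrm T ℱ β l) :
    nrm T ℱ x l = nrm T ℱ y l := by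
  induction l, hkl using Nat.le_induction with
  | base => exact hxy
  | succ l hkl ih =>
    have hx' := hS.together_mono hkl hxα hx
    have hy' := hS.together_mono hkl hyβ hy
    obtain ⟨E, hE, _, _, hαE⟩ := hx
    obtain ⟨E', hE', _, _, hβE⟩ := hy
    have hα := hS.mem_subset E hE hαE
    have hβ := hS.mem_subset E' hE' hβE
    obtain ⟨h1, h2⟩ := hS.nrm_eq_and_xi_eq_of_nrm_succ_eq hα hβ hαβ
    have h3 := ih h1
    rcases hS.xi_succ (hxα.trans hα) l with ⟨a1, a2, a3⟩ | ⟨a1, i, a2, a3⟩ <;>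
    rcases hS.xi_succ (hyβ.trans hβ) l with ⟨b1, b2, b3⟩ | ⟨b1, j, b2, b3⟩
    · omega
    · omega
    · omega
    · have hij : i = j := by
        have := hS.xi_succ_eq_or hxα hx'
        have := hS.xi_succ_eq_or hyβ hy'
        omega
      rw [a3, b3, h3, hij]

end IsConstructionScheme

theorem deltaOrd_comm (T : SchemeType) (ℱ : Set (Finset Ordinal)) (α β : Ordinal) :
    deltaOrd T ℱ α β = deltaOrd T ℱ β α := by
  simp only [deltaOrd, ne_comm]

theorem nrm_eq_of_lt_deltaOrd {T : SchemeType} {ℱ : Set (Finset Ordinal)} {α β : Ordinal} {j : ℕ}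
    (h : j < deltaOrd T ℱ α β) : nrm T ℱ α j = nrm T ℱ β j := by
  by_contra hne
  exact Nat.notMem_of_lt_sInf h hne

theorem deltaOrd_eq {T : SchemeType} {ℱ : Set (Finset Ordinal)} {α β : Ordinal} {l : ℕ}
    (hne : nrm T ℱ α l ≠ nrm T ℱ β l) (heq : ∀ j < l, nrm T ℱ α j = nrm T ℱ β j) :
    deltaOrd T ℱ α β = l := by
  refine le_antisymm (Nat.sInf_le hne) (le_of_not_gt fun hlt => ?_)
  exact (Nat.sInf_mem (s := {k | nrm T ℱ α k ≠ nrm T ℱ β k}) ⟨l, hne⟩) (heq _ hlt)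

/-- Above the level `k`, an element `x` between `α` and `β` has the same `Ξ` as `β`, provided
`α` is not in the root. -/
theorem IsConstructionScheme.xi_eq_of_between {T : SchemeType} {ℱ : Set (Finset Ordinal)}
    (hS : IsConstructionScheme T ℱ) {k l : ℕ} (hkl : k ≤ l) {α x β : Ordinal} (hαx : α ≤ x)
    (hxβ : x < β) (h : ∃ E ∈ ℱ, E.card = T.m k ∧ α ∈ E ∧ x ∈ E ∧ β ∈ E)
    (hα : Xi T ℱ α (l + 1) ≠ -1) : Xi T ℱ x (l + 1) = Xi T ℱ β (l + 1) := by
  obtain ⟨E, hE, hEk, hαE, hxE, hβE⟩ := h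
  rcases hS.xi_succ_eq_or hxβ (hS.together_mono hkl hxβ ⟨E, hE, hEk, hxE, hβE⟩) with hx | hx
  · rcases hαx.eq_or_lt with rfl | hαx
    · exact absurd hx hα
    have hle := hS.nrm_le_nrm hαx.le (hS.together_mono hkl hαx ⟨E, hE, hEk, hαE, hxE⟩)
    rcases hS.xi_succ (hS.mem_subset E hE hαE) l with ⟨_, h, _⟩ | ⟨h, _⟩
    · exact absurd h hα
    rcases hS.xi_succ (hS.mem_subset E hE hxE) l with ⟨h', _⟩ | ⟨_, i, h', _⟩
    · omega
    · omega
  · exact hx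

theorem IsConstructionScheme.nrm_ne_of_xi {T : SchemeType} {ℱ : Set (Finset Ordinal)}
    (hS : IsConstructionScheme T ℱ) {x y : Ordinal} (hx : x < omegaOne) (hy : y < omegaOne)
    {l : ℕ} (h : Xi T ℱ x l ≠ Xi T ℱ y l) : nrm T ℱ x l ≠ nrm T ℱ y l := by
  cases l with
  | zero => exact absurd (by simp [Xi]) h
  | succ l => exact fun heq => h (hS.nrm_eq_and_xi_eq_of_nrm_succ_eq hx hy heq).2

theorem nrm_elt_eq_of_map_sort_eq {A B : Finset Ordinal} {f : Ordinal → ℕ}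
    (h : A.sort.map f = B.sort.map f) {a : ℕ} (ha : a < A.card) :
    f (elt A a) = f (elt B a) := by
  have hc : A.card = B.card := by simpa using congrArg List.length h
  have := congrArg (fun L => L[a]?) h
  simpa [elt, ha, hc ▸ ha] using this

theorem deltaCapturedFam_pair {T : SchemeType} {ℱ : Set (Finset Ordinal)} {α β α' β' : Ordinal}
    (hαβ : α < β) (hαβ' : α' < β') (hdisj : Disjoint ({α, β} : Finset Ordinal) {α', β'}) {l : ℕ}
    (h : DeltaCapturedFam T ℱ 2 (pairFam {α, β} {α', β'}) l) :
    β < α' ∧ Xi T ℱ α l = 0 ∧ Xi T ℱ β l = 0 ∧ Xi T ℱ α' l = 1 ∧ Xi T ℱ β' l = 1 ∧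
      deltaOrd T ℱ β β' = l := by
  obtain ⟨R, -, hR, -, hlt, -, hXi, hΔ⟩ := h
  obtain rfl : R = ∅ := by
    rw [← hR 0 (by omega) 1 (by omega) (by omega)]
    exact Finset.disjoint_iff_inter_eq_empty.1 hdisj
  have hcard : ({α, β} : Finset Ordinal).card = 2 := Finset.card_pair hαβ.ne
  have hcard' : ({α', β'} : Finset Ordinal).card = 2 := Finset.card_pair hαβ'.ne
  have h00 := hXi 0 (by omega) 0 (by simp) (by simp [pairFam, hcard])
  have h01 := hXi 0 (by omega) 1 (by simp) (by simp [pairFam, hcard])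
  have h10 := hXi 1 (by omega) 0 (by simp) (by simp [pairFam, hcard'])
  have h11 := hXi 1 (by omega) 1 (by simp) (by simp [pairFam, hcard'])
  have h1 := hΔ 0 (by omega) 1 (by omega) (by omega) 1 (by simp) (by simp [pairFam, hcard])
  simp only [pairFam, if_true, one_ne_zero, if_false, elt_pair_zero hαβ, elt_pair_one hαβ,
    elt_pair_zero hαβ', elt_pair_one hαβ', Nat.cast_zero, Nat.cast_one] at h00 h01 h10 h11 h1
  exact ⟨hlt 0 1 (by omega) (by omega) β (by simp [pairFam]) α' (by simp [pairFam]),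
    h00, h01, h10, h11, h1⟩

theorem deltaCapturedFam_two {T : SchemeType} {ℱ : Set (Finset Ordinal)} {A B R : Finset Ordinal}
    {l : ℕ} (hcard : A.card = B.card) (hRA : R ⊆ A) (hRB : R ⊆ B)
    (hA : ∀ x ∈ R, ∀ y ∈ A \ R, x < y) (hB : ∀ x ∈ R, ∀ y ∈ B \ R, x < y)
    (hAB : ∀ x ∈ A \ R, ∀ y ∈ B \ R, x < y) (hR : ∀ x ∈ R, Xi T ℱ x l = -1)
    (hXA : ∀ x ∈ A \ R, Xi T ℱ x l = 0) (hXB : ∀ x ∈ B \ R, Xi T ℱ x l = 1)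
    (hΔ : ∀ a, R.card ≤ a → a < A.card → deltaOrd T ℱ (elt A a) (elt B a) = l) :
    DeltaCapturedFam T ℱ 2 (pairFam A B) l := by
  have hint : A ∩ B = R := by
    refine Finset.Subset.antisymm (fun x hx => ?_) (Finset.subset_inter hRA hRB)
    rw [Finset.mem_inter] at hx
    by_contra hxR
    exact lt_irrefl x (hAB x (Finset.mem_sdiff.2 ⟨hx.1, hxR⟩) x (Finset.mem_sdiff.2 ⟨hx.2, hxR⟩))
  have helt : ∀ {C : Finset Ordinal}, R ⊆ C → (∀ x ∈ R, ∀ y ∈ C \ R, x < y) →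
      ∀ a, R.card ≤ a → a < C.card → elt C a ∈ C \ R := fun hRC hC a hle ha =>
    Finset.mem_sdiff.2 ⟨elt_mem ha, fun h => hle.not_gt ((elt_mem_iff hRC hC ha).1 h)⟩
  refine ⟨R, ?_, ?_, ?_, ?_, ?_, ?_, ?_⟩
  · intro i hi j hj
    interval_cases i <;> interval_cases j <;> simp [pairFam, hcard]
  · intro i hi j hj hij
    interval_cases i <;> interval_cases j <;> simp_all [pairFam, Finset.inter_comm]
  · intro i hi
    interval_cases i
    · exact hA
    · exact hB
  · intro i j hij hj
    obtain ⟨rfl, rfl⟩ : i = 0 ∧ j = 1 := by omega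
    exact hAB
  · intro i hi a ha
    interval_cases i
    · exact hR _ ((elt_mem_iff hRA hA (ha.trans_le (Finset.card_le_card hRA))).2 ha)
    · exact hR _ ((elt_mem_iff hRB hB (ha.trans_le (Finset.card_le_card hRB))).2 ha)
  · intro i hi a hle ha
    interval_cases i
    · simpa [pairFam] using hXA _ (helt hRA hA a hle ha)
    · simpa [pairFam] using hXB _ (helt hRB hB a hle ha)
  · intro i hi j hj hij a hle ha
    interval_cases i <;> interval_cases j
    · omega
    · exact hΔ a hle ha
    · rw [deltaOrd_comm]
      exact hΔ a hle (hcard ▸ ha)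
    · omega

/-- The sets `A`, `B` inherit Δ-capturing from the pairs `{α, β}`, `{α', β'}`, where `α`, `α'`
are the first elements of `A`, `B` above the root and `β`, `β'` bound `A`, `B`. -/
theorem IsConstructionScheme.deltaCapturedFam_of_pair {T : SchemeType} {ℱ : Set (Finset Ordinal)}
    (hS : IsConstructionScheme T ℱ) {k l : ℕ} (hkl : k < l) {A B E E' R : Finset Ordinal}
    {α β α' β' : Ordinal} (hE : E ∈ ℱ) (hEk : E.card = T.m k) (hE' : E' ∈ ℱ)
    (hE'k : E'.card = T.m k) (hAE : A ⊆ E) (hβE : β ∈ E) (hBE : B ⊆ E') (hβE' : β' ∈ E')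
    (hRA : R ⊆ A) (hRB : R ⊆ B)
    (hA : ∀ x ∈ R, ∀ y ∈ A \ R, x < y) (hB : ∀ x ∈ R, ∀ y ∈ B \ R, x < y)
    (hαA : α ∈ A) (hα'B : α' ∈ B) (hα : ∀ x ∈ A \ R, α ≤ x) (hα' : ∀ x ∈ B \ R, α' ≤ x)
    (hβ : ∀ x ∈ A, x < β) (hβ' : ∀ x ∈ B, x < β')
    (hnrm : A.sort.map (nrm T ℱ · k) = B.sort.map (nrm T ℱ · k))
    (hdisj : Disjoint ({α, β} : Finset Ordinal) {α', β'})
    (h : DeltaCapturedFam T ℱ 2 (pairFam {α, β} {α', β'}) l) :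
    DeltaCapturedFam T ℱ 2 (pairFam A B) l := by
  obtain ⟨hlt, hXα, hXβ, hXα', hXβ', hΔ⟩ :=
    deltaCapturedFam_pair (hβ α hαA) (hβ' α' hα'B) hdisj h
  have hcard : A.card = B.card := by simpa using congrArg List.length hnrm
  have hEω := hS.mem_subset E hE
  have hE'ω := hS.mem_subset E' hE'
  obtain ⟨l, rfl⟩ : ∃ j, l = j + 1 := ⟨l - 1, by omega⟩
  have hkl' : k ≤ l := by omega
  have hXA : ∀ x ∈ A \ R, Xi T ℱ x (l + 1) = 0 := fun x hx => by
    have hxA := (Finset.mem_sdiff.1 hx).1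
    rw [hS.xi_eq_of_between hkl' (hα x hx) (hβ x hxA)
      ⟨E, hE, hEk, hAE hαA, hAE hxA, hβE⟩ (by omega), hXβ]
  have hXB : ∀ x ∈ B \ R, Xi T ℱ x (l + 1) = 1 := fun x hx => by
    have hxB := (Finset.mem_sdiff.1 hx).1
    rw [hS.xi_eq_of_between hkl' (hα' x hx) (hβ' x hxB)
      ⟨E', hE', hE'k, hBE hα'B, hBE hxB, hβE'⟩ (by omega), hXβ']
  refine deltaCapturedFam_two hcard hRA hRB hA hB ?_ ?_ hXA hXB ?_
  · exact fun x hx y hy => (hβ x (Finset.mem_sdiff.1 hx).1).trans (hlt.trans_le (hα' y hy))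
  · intro x hx
    have h1 := hS.xi_succ_eq_or (hβ x (hRA hx))
      (hS.together_mono hkl' (hβ x (hRA hx)) ⟨E, hE, hEk, hAE (hRA hx), hβE⟩)
    have h2 := hS.xi_succ_eq_or (hβ' x (hRB hx))
      (hS.together_mono hkl' (hβ' x (hRB hx)) ⟨E', hE', hE'k, hBE (hRB hx), hβE'⟩)
    omega
  · intro a hle ha
    have hxA := elt_mem ha
    have hyB := elt_mem (hcard ▸ ha)
    have hxR : elt A a ∈ A \ R :=
      Finset.mem_sdiff.2 ⟨hxA, fun h => hle.not_gt ((elt_mem_iff hRA hA ha).1 h)⟩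
    have hyR : elt B a ∈ B \ R :=
      Finset.mem_sdiff.2 ⟨hyB, fun h => hle.not_gt ((elt_mem_iff hRB hB (hcard ▸ ha)).1 h)⟩
    have hk := nrm_elt_eq_of_map_sort_eq hnrm ha
    refine deltaOrd_eq (hS.nrm_ne_of_xi (hEω (hAE hxA)) (hE'ω (hBE hyB)) ?_) fun j hj => ?_
    · rw [hXA _ hxR, hXB _ hyR]
      decide
    · rcases le_total k j with hkj | hjk
      · exact hS.nrm_eq_of_together hkj (hβ _ hxA) (hβ' _ hyB) ⟨E, hE, hEk, hAE hxA, hβE⟩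
          ⟨E', hE', hE'k, hBE hyB, hβE'⟩ hk (nrm_eq_of_lt_deltaOrd (hΔ ▸ hj))
      · exact hS.nrm_eq_of_le (hEω (hAE hxA)) (hE'ω (hBE hyB)) hjk hk

theorem IsConstructionScheme.exists_upper_bound {T : SchemeType} {ℱ : Set (Finset Ordinal)}
    (hS : IsConstructionScheme T ℱ) {A : Finset Ordinal} (hA : ↑A ⊆ Set.Iio omegaOne) :
    ∃ β k E, E ∈ ℱ ∧ E.card = T.m k ∧ A ⊆ E ∧ β ∈ E ∧ ∀ x ∈ A, x < β := by
  have hlim := Cardinal.isSuccLimit_ord (Cardinal.aleph0_le_aleph 1)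
  have hβ : A.sup Order.succ < omegaOne :=
    (Finset.sup_lt_iff hlim.bot_lt).2 fun x hx => hlim.succ_lt (hA hx)
  obtain ⟨k, E, hE, hEk, hsub⟩ := hS.exists_level_superset (A := insert (A.sup Order.succ) A) (by
    rw [Finset.coe_insert]
    exact Set.insert_subset hβ hA)
  exact ⟨_, k, E, hE, hEk, (Finset.subset_insert _ _).trans hsub,
    hsub (Finset.mem_insert_self _ _),
    fun x hx => (Order.lt_succ x).trans_le (Finset.le_sup (f := Order.succ) hx)⟩

/-- A scheme `ℱ` is 2-Δ-capturing iff for every uncountable family `𝒮` of pairwise disjoint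
2-element subsets of `ω₁` there are infinitely many levels `l` at which some two distinct
members of `𝒮` are Δ-captured. -/
theorem stmt16 (T : SchemeType) (ℱ : Set (Finset Ordinal))
    (hS : IsConstructionScheme T ℱ) :
    TwoDeltaCapturing T ℱ ↔
      ∀ 𝒮 : Set (Finset Ordinal),
        (∀ A ∈ 𝒮, A.card = 2 ∧ ↑A ⊆ Set.Iio omegaOne) →
        (𝒮.Pairwise fun A B => Disjoint A B) →
        ¬ 𝒮.Countable →
        {l : ℕ | ∃ A ∈ 𝒮, ∃ B ∈ 𝒮, A ≠ B ∧
          DeltaCapturedFam T ℱ 2 (pairFam A B) l}.Infinite := by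
  constructor
  · intro h 𝒮 h𝒮 _ hunc
    refine h 𝒮 (fun A hA => ⟨Finset.card_pos.1 ?_, (h𝒮 A hA).2⟩) hunc
    rw [(h𝒮 A hA).1]
    exact two_pos
  intro h 𝒮 h𝒮 hunc
  obtain ⟨R, X, G, hX, hG⟩ := exists_root hunc
  choose! β k E hE hEk hGE hβE hβ using fun α (hα : α ∈ X) =>
    hS.exists_upper_bound (h𝒮 _ (hG α hα).1).2
  have hαG : ∀ α ∈ X, α ∈ G α := fun α hα => (Finset.mem_sdiff.1 (hG α hα).2.2.1).1
  have hfiber := exists_uncountable_fiber hX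
    (fun α => (k α, (G α).sort.map (nrm T ℱ · (k α)))) (Set.to_countable _)
  obtain ⟨⟨k₀, L⟩, hY⟩ := hfiber
  obtain ⟨Z, hZY, hZ, hdisj⟩ := exists_uncountable_pairwise_disjoint hY
    (fun α => ({α, β α} : Finset Ordinal)) (fun _ _ => by simp) (by
      intro x
      by_cases hx : x < omegaOne
      · refine (countable_Iic_of_lt_omegaOne hx).mono ?_
        rintro α ⟨⟨hα, _⟩, hxα⟩
        rw [Finset.mem_insert, Finset.mem_singleton] at hxα
        rcases hxα with rfl | rfl
        · exact le_refl x
        · exact (hβ α hα α (hαG α hα)).le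
      · refine Set.countable_empty.mono ?_
        rintro α ⟨⟨hα, _⟩, hxα⟩
        rw [Finset.mem_insert, Finset.mem_singleton] at hxα
        rcases hxα with rfl | rfl
        · exact hx (hS.mem_subset _ (hE x hα) (hGE x hα (hαG x hα)))
        · exact hx (hS.mem_subset _ (hE α hα) (hβE α hα)))
  have hinj : Set.InjOn (fun α => ({α, β α} : Finset Ordinal)) Z := by
    intro α hα α' hα' heq
    by_contra hne
    have hd : Disjoint ({α, β α} : Finset Ordinal) {α', β α'} := hdisj hα hα' hne
    simp only at heq
    rw [← heq, disjoint_self] at hd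
    simp at hd
  have hinf := h ((fun α => ({α, β α} : Finset Ordinal)) '' Z) (by
      rintro _ ⟨α, hα, rfl⟩
      have hαX := (hZY hα).1
      have hlt := hβ α hαX α (hαG α hαX)
      refine ⟨Finset.card_pair hlt.ne, ?_⟩
      have hβω := hS.mem_subset _ (hE α hαX) (hβE α hαX)
      rw [Finset.coe_pair]
      exact Set.insert_subset (hlt.trans hβω) (Set.singleton_subset_iff.2 hβω))
    (by
      rintro _ ⟨α, hα, rfl⟩ _ ⟨α', hα', rfl⟩ hne
      exact hdisj hα hα' fun h => hne (h ▸ rfl))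
    (fun hc => hZ ((Set.mapsTo_image _ _).countable_of_injOn hinj hc))
  refine (hinf.sdiff (Set.finite_Iic k₀)).mono ?_
  rintro l ⟨⟨_, ⟨α, hα, rfl⟩, _, ⟨α', hα', rfl⟩, hne, hcap⟩, hl⟩
  have hαα' : α ≠ α' := fun h => hne (h ▸ rfl)
  obtain ⟨hαX, hcα⟩ := hZY hα
  obtain ⟨hα'X, hcα'⟩ := hZY hα'
  rw [Prod.mk.injEq] at hcα hcα'
  obtain ⟨hkα, hLα⟩ := hcα
  obtain ⟨hkα', hLα'⟩ := hcα'
  rw [hkα] at hLα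
  rw [hkα'] at hLα'
  obtain ⟨hGα, hRα, hαR, hltα, hleα⟩ := hG α hαX
  obtain ⟨hGα', hRα', hαR', hltα', hleα'⟩ := hG α' hα'X
  refine ⟨G α, hGα, G α', hGα', fun heq => ?_, ?_⟩
  · exact hαα' (le_antisymm (hleα _ (heq ▸ hαR')) (hleα' _ (heq ▸ hαR)))
  · exact hS.deltaCapturedFam_of_pair (not_le.1 hl) (hE α hαX) (hkα ▸ hEk α hαX) (hE α' hα'X)
      (hkα' ▸ hEk α' hα'X) (hGE α hαX) (hβE α hαX) (hGE α' hα'X) (hβE α' hα'X) hRα hRα' hltα hltα'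
      (hαG α hαX) (hαG α' hα'X) hleα hleα' (hβ α hαX) (hβ α' hα'X) (hLα.trans hLα'.symm)
      (hdisj hα hα' hαα') hcap

end
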